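/- (Interpolation error for QR pivot sensors.) Let n, r, p be natural numbers with 1 ≤ r < n and r ≤ p. Let Ψ, Φ ∈ ℝ^{n×r} and C ∈ ℝ^{p×n}, and suppose U := C Ψ has full column rank. Suppose Uᵀ admits a pivoted QR factorization Uᵀ P = Q R with P a p×p permutation matrix, Q ∈ ℝ^{r×r} orthogonal, and R ∈ ℝ^{r×p} upper triangular satisfying the Businger–Golub diagonal dominance property. Let S ∈ ℝ^{r×p} be the row-selection matrix formed by transposing the first r columns of P, set Ĉ := S C, and define P_C := Ψ (ĈΨ)⁻¹ Ĉ. Let x ∈ ℝⁿ, x⋆ := Ψ Φᵀ x, and suppose ‖x − x⋆‖₂ ≤ 2 Σ_{i=r+1}^{n} σᵢ for given nonnegative reals σ_{r+1}, …, σ_n. Then ‖x − P_C x‖₂ ≤ ( ‖C‖₂ ‖Ψ‖₂ / σ_min(CΨ) ) · √(p − r + 1) · ( √(4^r + 6r − 1) / 3 ) · 2 Σ_{i=r+1}^{n} σᵢ. -/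

import Mathlib

open Matrix

/-- Spectral norm (ℓ₂→ℓ₂ operator norm) of a real matrix. -/
noncomputable def specNorm {m n : ℕ} (M : Matrix (Fin m) (Fin n) ℝ) : ℝ :=
  ‖LinearMap.toContinuousLinearMap (Matrix.toEuclideanLin M)‖

/-- Euclidean norm of a vector in ℝⁿ. -/
noncomputable def euclNorm {n : ℕ} (x : Fin n → ℝ) : ℝ :=
  ‖(EuclideanSpace.equiv (Fin n) ℝ).symm x‖

/-- Smallest singular value of a matrix: the infimum of `‖Ux‖₂` over the unit sphere. -/
noncomputable def sigmaMin {p r : ℕ} (U : Matrix (Fin p) (Fin r) ℝ) : ℝ :=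
  sInf {c : ℝ | ∃ x : Fin r → ℝ, euclNorm x = 1 ∧ c = euclNorm (U.mulVec x)}

/-- A permutation matrix: exactly one entry 1 in each row and column, zeros elsewhere. -/
def IsPermMatrix {p : ℕ} (P : Matrix (Fin p) (Fin p) ℝ) : Prop :=
  ∃ σ : Equiv.Perm (Fin p), P = σ.permMatrix ℝ

/-- Upper triangular (possibly rectangular) matrix: `R j k = 0` for `j > k`. -/
def IsUpperTri {r p : ℕ} (R : Matrix (Fin r) (Fin p) ℝ) : Prop :=
  ∀ (j : Fin r) (k : Fin p), (k : ℕ) < (j : ℕ) → R j k = 0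

/-- Businger–Golub diagonal dominance:
`|R i i|² ≥ Σ_{j=i}^{min(k,r)} |R j k|²` for all `i ≤ k`. -/
def BusingerGolub {r p : ℕ} (R : Matrix (Fin r) (Fin p) ℝ) : Prop :=
  ∀ (i : Fin r) (ip : Fin p) (k : Fin p), (i : ℕ) = (ip : ℕ) → (ip : ℕ) ≤ (k : ℕ) →
    (∑ j : Fin r, if (i : ℕ) ≤ (j : ℕ) ∧ (j : ℕ) ≤ (k : ℕ) then (R j k) ^ 2 else 0)
      ≤ (R i ip) ^ 2

theorem euclNorm_nonneg {n : ℕ} (x : Fin n → ℝ) : 0 ≤ euclNorm x := norm_nonneg _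

theorem euclNorm_sq {n : ℕ} (x : Fin n → ℝ) : euclNorm x ^ 2 = ∑ i, x i ^ 2 := by
  simp [euclNorm, EuclideanSpace.norm_sq_eq]

theorem euclNorm_mulVec_le {m n : ℕ} (M : Matrix (Fin m) (Fin n) ℝ) (x : Fin n → ℝ) :
    euclNorm (M *ᵥ x) ≤ specNorm M * euclNorm x :=
  (LinearMap.toContinuousLinearMap (Matrix.toEuclideanLin M)).le_opNorm
    ((EuclideanSpace.equiv (Fin n) ℝ).symm x)

theorem specNorm_nonneg {m n : ℕ} (M : Matrix (Fin m) (Fin n) ℝ) : 0 ≤ specNorm M :=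
  norm_nonneg _

theorem euclNorm_eq_zero {n : ℕ} {x : Fin n → ℝ} : euclNorm x = 0 ↔ x = 0 := by
  simp [euclNorm]

theorem euclNorm_mulVec_sq_le_frobenius {m n : ℕ} (M : Matrix (Fin m) (Fin n) ℝ)
    (x : Fin n → ℝ) :
    euclNorm (M *ᵥ x) ^ 2 ≤ (∑ i, ∑ j, M i j ^ 2) * euclNorm x ^ 2 := by
  rw [euclNorm_sq, euclNorm_sq, Finset.sum_mul]
  exact Finset.sum_le_sum fun i _ => by
    simp only [mulVec, dotProduct]
    exact Finset.sum_mul_sq_le_sq_mul_sq _ _ _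

theorem euclNorm_mulVec_of_orthogonal {m n : ℕ} {Q : Matrix (Fin m) (Fin n) ℝ}
    (hQ : Qᵀ * Q = 1) (x : Fin n → ℝ) : euclNorm (Q *ᵥ x) = euclNorm x := by
  have h (k : ℕ) (y : Fin k → ℝ) : euclNorm y ^ 2 = y ⬝ᵥ y := by
    rw [euclNorm_sq]; simp [dotProduct, sq]
  rw [← sq_eq_sq₀ (euclNorm_nonneg _) (euclNorm_nonneg _), h, h, dotProduct_mulVec,
    vecMul_mulVec, hQ, vecMul_one]

theorem norm_sub_apply_le_of_idempotent {E : Type*} [NormedAddCommGroup E]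
    [InnerProductSpace ℝ E] (T : E →ₗ[ℝ] E) (hT : ∀ y, T (T y) = T y) {K : ℝ} (hK : 1 ≤ K)
    (hTK : ∀ y, ‖T y‖ ≤ K * ‖y‖) (y : E) : ‖y - T y‖ ≤ K * ‖y‖ := by
  obtain ⟨a, ha⟩ : ∃ a, a = y - T y := ⟨_, rfl⟩
  obtain ⟨b, hb⟩ : ∃ b, b = T y := ⟨_, rfl⟩
  have hTa : T a = 0 := by rw [ha, map_sub, hT, sub_self]
  have hTb : T b = b := by rw [hb, hT]
  have hy : y = a + b := by rw [ha, hb]; abel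
  rw [← ha]
  rcases eq_or_ne a 0 with h0 | h0
  · rw [h0, norm_zero]; positivity
  rcases eq_or_ne b 0 with h1 | h1
  · rw [hy, h1, add_zero]
    exact le_mul_of_one_le_left (norm_nonneg _) hK
  have ha' : ‖a‖ ≠ 0 := norm_ne_zero_iff.2 h0
  have hb' : ‖b‖ ≠ 0 := norm_ne_zero_iff.2 h1
  have key := hTK ((‖b‖ / ‖a‖) • a + (‖a‖ / ‖b‖) • b)
  have hz : ‖(‖b‖ / ‖a‖) • a + (‖a‖ / ‖b‖) • b‖ = ‖a + b‖ := by
    rw [← sq_eq_sq₀ (norm_nonneg _) (norm_nonneg _), norm_add_sq_real, norm_add_sq_real,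
      norm_smul, norm_smul, real_inner_smul_left, real_inner_smul_right]
    simp only [norm_div, norm_norm]
    field_simp
    ring
  rw [hz, map_add, map_smul, map_smul, hTa, hTb, smul_zero, zero_add, norm_smul, norm_div,
    norm_norm, norm_norm, div_mul_cancel₀ _ hb'] at key
  rwa [hy]

theorem tail_sum_le_of_le_tail_sum {r j : ℕ} {c : ℝ} (hc : 0 ≤ c) (u : ℕ → ℝ)
    (hu : ∀ i < r, u i ≤ (if i = j then c else 0) + ∑ k ∈ Finset.Ico (i + 1) r, u k)
    {i : ℕ} (hi : i ≤ r) :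
    ∑ k ∈ Finset.Ico i r, u k ≤ if i ≤ j then c * 2 ^ (j - i) else 0 := by
  induction hi using Nat.decreasingInduction with
  | self => simp only [Finset.Ico_self, Finset.sum_empty]; split_ifs <;> positivity
  | of_succ i hi ih =>
    rw [Finset.sum_eq_sum_Ico_succ_bot hi]
    have h := hu i hi
    rcases lt_trichotomy i j with hij | rfl | hij
    · rw [if_neg hij.ne] at h
      rw [if_pos (Nat.succ_le_of_lt hij)] at ih
      rw [if_pos hij.le, show j - i = (j - (i + 1)) + 1 by omega, pow_succ]
      linarith
    · simp at h ih ⊢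
      linarith
    · rw [if_neg hij.ne'] at h
      rw [if_neg (by omega)] at ih
      rw [if_neg (by omega)]
      linarith

theorem le_pow_of_le_tail_sum {r j : ℕ} {c : ℝ} (hc : 0 ≤ c) (u : ℕ → ℝ)
    (hu : ∀ i < r, u i ≤ (if i = j then c else 0) + ∑ k ∈ Finset.Ico (i + 1) r, u k)
    {i : ℕ} (hi : i < r) :
    u i ≤ c * if i = j then 1 else if i < j then 2 ^ (j - 1 - i) else 0 := by
  have h := (hu i hi).trans (add_le_add_right (tail_sum_le_of_le_tail_sum hc u hu hi) _)
  rcases lt_trichotomy i j with hij | rfl | hij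
  · simpa [hij.ne, hij, Nat.sub_sub, Nat.add_comm 1 i, Nat.succ_le_of_lt hij] using h
  · simpa using h
  · simpa [hij.ne', hij.not_gt, show ¬ i + 1 ≤ j by omega] using h

theorem sum_sq_inverse_weights (r : ℕ) :
    ∑ j ∈ Finset.range r, ∑ i ∈ Finset.range r,
      (if i = j then (1 : ℝ) else if i < j then 2 ^ (j - 1 - i) else 0) ^ 2
      = ((4 : ℝ) ^ r + 6 * r - 1) / 9 := by
  have hcol : ∀ j ∈ Finset.range r, ∑ i ∈ Finset.range r,
      (if i = j then (1 : ℝ) else if i < j then 2 ^ (j - 1 - i) else 0) ^ 2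
      = ((4 : ℝ) ^ j + 2) / 3 := by
    intro j hj
    rw [← Finset.sum_subset (Finset.range_subset_range.2 (Finset.mem_range.1 hj))
      (fun i _ hi => by
        simp only [Finset.mem_range] at hi
        rw [if_neg (by omega), if_neg (by omega)]; norm_num),
      Finset.sum_range_succ]
    have h : ∑ i ∈ Finset.range j,
        (if i = j then (1 : ℝ) else if i < j then 2 ^ (j - 1 - i) else 0) ^ 2
        = ∑ i ∈ Finset.range j, (4 : ℝ) ^ (j - 1 - i) := by
      refine Finset.sum_congr rfl fun i hi => ?_
      have hi := Finset.mem_range.1 hi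
      rw [if_neg hi.ne, if_pos hi, ← pow_mul, mul_comm, pow_mul]; norm_num
    rw [h, Finset.sum_range_reflect (fun i => (4 : ℝ) ^ i), geom_sum_eq (by norm_num)]
    simp only [if_true]
    ring
  rw [Finset.sum_congr rfl hcol, ← Finset.sum_div, Finset.sum_add_distrib,
    geom_sum_eq (by norm_num)]
  simp only [Finset.sum_const, Finset.card_range, nsmul_eq_mul]
  ring

/-- Frobenius norm bound for the inverse of a row-dominated upper triangular matrix. -/
theorem sum_sq_inv_le_of_upperTri {r : ℕ} {A : Matrix (Fin r) (Fin r) ℝ} (hA : IsUpperTri A)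
    (hdet : IsUnit A.det) (hdom : ∀ i k, |A i k| ≤ |A i i|) {m : ℝ} (hm : 0 < m)
    (hdiag : ∀ i, m ≤ |A i i|) :
    ∑ i, ∑ j, A⁻¹ i j ^ 2 ≤ ((4 : ℝ) ^ r + 6 * r - 1) / 9 / m ^ 2 := by
  have hentry (i j : Fin r) : |A⁻¹ i j| ≤
      m⁻¹ * if (i : ℕ) = j then 1 else if (i : ℕ) < j then 2 ^ ((j : ℕ) - 1 - i) else 0 := by
    have hu := le_pow_of_le_tail_sum (r := r) (j := j) (inv_nonneg.2 hm.le)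
      (fun k => if hk : k < r then |A⁻¹ ⟨k, hk⟩ j| else 0) ?_ i.2
    · simpa using hu
    intro k hk
    obtain ⟨k, rfl⟩ : ∃ k' : Fin r, (k' : ℕ) = k := ⟨⟨k, hk⟩, rfl⟩
    have htail : ∑ l ∈ Finset.Ico ((k : ℕ) + 1) r, (if hl : l < r then |A⁻¹ ⟨l, hl⟩ j| else 0)
        = ∑ l ∈ Finset.Ioi k, |A⁻¹ l j| := by
      symm
      refine Finset.sum_bij (fun l _ => (l : ℕ)) ?_ ?_ ?_ ?_
      · intro l hl
        have := Finset.mem_Ioi.1 hl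
        simp only [Finset.mem_Ico]
        exact ⟨this, l.2⟩
      · intro a _ b _ h
        exact Fin.ext h
      · intro l hl
        have := Finset.mem_Ico.1 hl
        exact ⟨⟨l, this.2⟩, Finset.mem_Ioi.2 this.1, rfl⟩
      · intro l _
        simp
    rw [htail]
    simp only [Fin.is_lt, dite_true, Fin.eta]
    have hmul := congrFun (congrFun (Matrix.mul_nonsing_inv A hdet) k) j
    rw [Matrix.mul_apply, ← Finset.sum_subset (Finset.subset_univ (Finset.Ici k))
      (fun l _ hl => by
        rw [hA k l (by simpa using hl), zero_mul]),
      ← Finset.Ioi_insert, Finset.sum_insert (by simp)] at hmul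
    have hkk : 0 < |A k k| := hm.trans_le (hdiag k)
    have hrow : |∑ l ∈ Finset.Ioi k, A k l * A⁻¹ l j|
        ≤ |A k k| * ∑ l ∈ Finset.Ioi k, |A⁻¹ l j| := by
      rw [Finset.mul_sum]
      refine (Finset.abs_sum_le_sum_abs _ _).trans (Finset.sum_le_sum fun l _ => ?_)
      rw [abs_mul]
      exact mul_le_mul_of_nonneg_right (hdom k l) (abs_nonneg _)
    have hone : |(1 : Matrix (Fin r) (Fin r) ℝ) k j|
        ≤ |A k k| * if (k : ℕ) = j then m⁻¹ else 0 := by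
      rcases eq_or_ne k j with rfl | hkj
      · simp only [Matrix.one_apply_eq, abs_one, if_true]
        rw [← div_eq_mul_inv, one_le_div hm]
        exact hdiag k
      · simp [Matrix.one_apply_ne hkj, Fin.val_ne_of_ne hkj]
    refine le_of_mul_le_mul_left ?_ hkk
    rw [mul_add, ← abs_mul, eq_sub_of_add_eq hmul]
    exact (abs_sub _ _).trans (add_le_add hone hrow)
  have hsum := sum_sq_inverse_weights r
  calc ∑ i, ∑ j, A⁻¹ i j ^ 2
      ≤ ∑ i : Fin r, ∑ j : Fin r, (m⁻¹ *
        if (i : ℕ) = j then 1 else if (i : ℕ) < j then 2 ^ ((j : ℕ) - 1 - i) else 0) ^ 2 := by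
        refine Finset.sum_le_sum fun i _ => Finset.sum_le_sum fun j _ => ?_
        rw [← sq_abs]
        exact pow_le_pow_left₀ (abs_nonneg _) (hentry i j) 2
    _ = (m⁻¹) ^ 2 * ∑ j ∈ Finset.range r, ∑ i ∈ Finset.range r,
      (if i = j then (1 : ℝ) else if i < j then 2 ^ (j - 1 - i) else 0) ^ 2 := by
        rw [Finset.sum_comm]
        simp only [mul_pow, ← Finset.mul_sum, Finset.sum_range]
    _ = _ := by rw [hsum]; ring

theorem mulVec_injective_of_rank_eq {p r : ℕ} {U : Matrix (Fin p) (Fin r) ℝ} (hU : U.rank = r) :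
    Function.Injective U.mulVec := by
  have h := LinearMap.finrank_range_add_finrank_ker U.mulVecLin
  rw [Module.finrank_fin_fun] at h
  have h0 : Module.finrank ℝ (LinearMap.ker U.mulVecLin) = 0 := by
    have : Module.finrank ℝ (LinearMap.range U.mulVecLin) = r := hU
    omega
  exact LinearMap.ker_eq_bot.1 (Submodule.finrank_eq_zero.1 h0)

theorem sq_le_sq_diag_of_businger {r p : ℕ} (hrp : r ≤ p) {R : Matrix (Fin r) (Fin p) ℝ}
    (hR : BusingerGolub R) {i j : Fin r} {k : Fin p} (hij : i ≤ j) (hjk : (j : ℕ) ≤ k) :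
    R j k ^ 2 ≤ R i (Fin.castLE hrp i) ^ 2 := by
  have hij' : (i : ℕ) ≤ j := hij
  refine le_trans ?_ (hR i (Fin.castLE hrp i) k rfl (hij'.trans hjk))
  simpa only [if_pos (And.intro hij' hjk)] using Finset.single_le_sum
    (f := fun j : Fin r => if (i : ℕ) ≤ (j : ℕ) ∧ (j : ℕ) ≤ (k : ℕ) then (R j k) ^ 2 else 0)
    (fun j _ => ite_nonneg (sq_nonneg _) le_rfl) (Finset.mem_univ j)

theorem sum_sq_row_le_of_businger {r p : ℕ} (hrp : r ≤ p) {R : Matrix (Fin r) (Fin p) ℝ}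
    (hRtri : IsUpperTri R) (hR : BusingerGolub R) (i : Fin r) :
    ∑ k, R i k ^ 2 ≤ ((p : ℝ) - i) * R i (Fin.castLE hrp i) ^ 2 := by
  rw [← Finset.sum_subset (Finset.subset_univ (Finset.Ici (Fin.castLE hrp i))) fun k _ hk => by
    rw [hRtri i k (by simpa [Fin.lt_def] using hk), zero_pow two_ne_zero]]
  refine (Finset.sum_le_card_nsmul _ _ _ fun k hk =>
    sq_le_sq_diag_of_businger hrp hR le_rfl (Fin.le_def.1 (Finset.mem_Ici.1 hk))).trans_eq ?_
  rw [Fin.card_Ici, nsmul_eq_mul, Fin.val_castLE, Nat.cast_sub (i.2.le.trans hrp)]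

theorem sigmaMin_mul_le {p r : ℕ} (U : Matrix (Fin p) (Fin r) ℝ) {x : Fin r → ℝ}
    (hx : euclNorm x = 1) : sigmaMin U ≤ euclNorm (U *ᵥ x) :=
  csInf_le ⟨0, by rintro _ ⟨y, _, rfl⟩; exact euclNorm_nonneg _⟩ ⟨x, hx, rfl⟩

theorem euclNorm_single_one {r : ℕ} (i : Fin r) : euclNorm (Pi.single i 1 : Fin r → ℝ) = 1 := by
  rw [← sq_eq_sq₀ (euclNorm_nonneg _) zero_le_one, euclNorm_sq]
  simp [Pi.single_apply]

theorem euclNorm_submatrix_mulVec_le {p r : ℕ} {P : Matrix (Fin p) (Fin p) ℝ} (hP : Pᵀ * P = 1)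
    {e : Fin r → Fin p} (he : Function.Injective e) (v : Fin p → ℝ) :
    euclNorm (P.submatrix e id *ᵥ v) ≤ euclNorm v := by
  rw [← euclNorm_mulVec_of_orthogonal hP v, ← sq_le_sq₀ (euclNorm_nonneg _) (euclNorm_nonneg _),
    euclNorm_sq, euclNorm_sq]
  calc ∑ i, (P.submatrix e id *ᵥ v) i ^ 2 = ∑ k ∈ Finset.univ.map ⟨e, he⟩, (P *ᵥ v) k ^ 2 := by
        rw [Finset.sum_map]; rfl
    _ ≤ _ := Finset.sum_le_sum_of_subset_of_nonneg (Finset.subset_univ _)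
        fun _ _ _ => sq_nonneg _

/-- A nonzero idempotent matrix and its complementary projection obey the same norm bounds. -/
theorem euclNorm_sub_mulVec_le_of_idempotent {n : ℕ} {T : Matrix (Fin n) (Fin n) ℝ}
    (hT : T * T = T) (hT0 : T ≠ 0) {K : ℝ} (hTK : ∀ y, euclNorm (T *ᵥ y) ≤ K * euclNorm y)
    (y : Fin n → ℝ) : euclNorm (y - T *ᵥ y) ≤ K * euclNorm y := by
  have hK : 1 ≤ K := by
    obtain ⟨v, hv⟩ : ∃ v, T *ᵥ v ≠ 0 := by
      by_contra! h
      exact hT0 (Matrix.ext_of_mulVec_single fun i => by rw [h, zero_mulVec])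
    have h := hTK (T *ᵥ v)
    rw [mulVec_mulVec, hT] at h
    have hpos : 0 < euclNorm (T *ᵥ v) :=
      (euclNorm_nonneg _).lt_of_ne' (mt euclNorm_eq_zero.1 hv)
    exact le_of_mul_le_mul_right (by rwa [one_mul]) hpos
  exact norm_sub_apply_le_of_idempotent (Matrix.toEuclideanLin T)
    (fun z => congrArg (WithLp.toLp 2) (by
      change T *ᵥ (T *ᵥ z.ofLp) = T *ᵥ z.ofLp
      rw [mulVec_mulVec, hT]))
    hK (fun z => hTK z.ofLp) (WithLp.toLp 2 y)

/-- Norm bound for the inverse of the rows of `U` picked by a pivoted QR factorization of `Uᵀ`. -/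
theorem isUnit_and_euclNorm_inv_mulVec_le_of_pivoted_qr {p r : ℕ} (hr : 1 ≤ r) (hrp : r ≤ p)
    {U : Matrix (Fin p) (Fin r) ℝ} (hU : Function.Injective U.mulVec)
    {P : Matrix (Fin p) (Fin p) ℝ} (hP : P * Pᵀ = 1)
    {Q : Matrix (Fin r) (Fin r) ℝ} (hQ : Qᵀ * Q = 1)
    {R : Matrix (Fin r) (Fin p) ℝ} (hRtri : IsUpperTri R) (hRbg : BusingerGolub R)
    (hQR : Uᵀ * P = Q * R) :
    IsUnit (Pᵀ.submatrix (Fin.castLE hrp) id * U).det ∧ 0 < sigmaMin U ∧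
    ∀ v, euclNorm ((Pᵀ.submatrix (Fin.castLE hrp) id * U)⁻¹ *ᵥ v) ≤
      Real.sqrt ((p : ℝ) - r + 1) * (Real.sqrt ((4 : ℝ) ^ r + 6 * r - 1) / 3) / sigmaMin U
        * euclNorm v := by
  have hQ' : Q * Qᵀ = 1 := mul_eq_one_comm.1 hQ
  obtain ⟨A, hA⟩ : ∃ A, A = R.submatrix id (Fin.castLE hrp) := ⟨_, rfl⟩
  have hG : Pᵀ.submatrix (Fin.castLE hrp) id * U = Aᵀ * Qᵀ := by
    have h := congrArg (fun M => (M.submatrix id (Fin.castLE hrp))ᵀ) hQR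
    simp only [transpose_submatrix, transpose_mul, transpose_transpose] at h
    rw [hA, transpose_submatrix]
    exact h
  obtain ⟨l, hl⟩ : ∃ l : Fin r, (l : ℕ) = r - 1 := ⟨⟨r - 1, by omega⟩, rfl⟩
  obtain ⟨m, hm⟩ : ∃ m, m = |A l l| := ⟨_, rfl⟩
  have hm0 : 0 ≤ m := hm ▸ abs_nonneg _
  have hdiag (i : Fin r) : m ≤ |A i i| := by
    rw [hm, ← sq_le_sq, hA]
    have hil : i ≤ l := Fin.le_def.2 (by omega)
    exact sq_le_sq_diag_of_businger hrp hRbg hil le_rfl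
  have hAtri : IsUpperTri A := fun j k hjk => by rw [hA]; exact hRtri j _ hjk
  have hdom (i k : Fin r) : |A i k| ≤ |A i i| := by
    rcases lt_or_ge k i with h | h
    · rw [hAtri i k h, abs_zero]
      exact abs_nonneg _
    · rw [← sq_le_sq, hA]
      exact sq_le_sq_diag_of_businger hrp hRbg le_rfl h
  obtain ⟨q, hq⟩ : ∃ q, q = Q *ᵥ Pi.single l 1 := ⟨_, rfl⟩
  have hq1 : euclNorm q = 1 := by
    rw [hq, euclNorm_mulVec_of_orthogonal hQ, euclNorm_single_one]
  have hp1 : 0 ≤ (p : ℝ) - r + 1 := by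
    have : (r : ℝ) ≤ p := by exact_mod_cast hrp
    linarith
  have hUq : euclNorm (U *ᵥ q) ≤ Real.sqrt ((p : ℝ) - r + 1) * m := by
    rw [← sq_le_sq₀ (euclNorm_nonneg _) (by positivity), mul_pow, Real.sq_sqrt hp1,
      ← euclNorm_mulVec_of_orthogonal (Q := Pᵀ) (by rwa [transpose_transpose]), mulVec_mulVec,
      show Pᵀ * U = Rᵀ * Qᵀ by simpa using congrArg transpose hQR, hq, mulVec_mulVec,
      Matrix.mul_assoc, hQ, Matrix.mul_one, euclNorm_sq, hm, sq_abs]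
    have h := sum_sq_row_le_of_businger hrp hRtri hRbg l
    rw [hl, Nat.cast_sub hr, Nat.cast_one] at h
    simp only [mulVec_single_one, col_apply, transpose_apply, hA, submatrix_apply, id]
    linarith
  have hmpos : 0 < m := by
    refine hm0.lt_of_ne' fun h0 => ?_
    rw [h0, mul_zero] at hUq
    have h := euclNorm_eq_zero.1 (le_antisymm hUq (euclNorm_nonneg _))
    have hq0 : q = 0 := hU (by rw [h, mulVec_zero])
    rw [euclNorm_eq_zero.2 hq0] at hq1
    exact zero_ne_one hq1
  have hAdet : IsUnit A.det := by
    rw [det_of_isUpperTriangular fun i j hij => hAtri i j hij, isUnit_iff_ne_zero,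
      Finset.prod_ne_zero_iff]
    exact fun i _ => abs_pos.1 (hmpos.trans_le (hdiag i))
  have hleft : (Q * A⁻¹ᵀ) * (Pᵀ.submatrix (Fin.castLE hrp) id * U) = 1 := by
    rw [hG, Matrix.mul_assoc, ← Matrix.mul_assoc (A⁻¹ᵀ), ← transpose_mul, mul_nonsing_inv _ hAdet,
      transpose_one, Matrix.one_mul, hQ']
  obtain ⟨c, hc⟩ : ∃ c, c = Real.sqrt ((4 : ℝ) ^ r + 6 * r - 1) / 3 := ⟨_, rfl⟩
  have hrad : 0 < (4 : ℝ) ^ r + 6 * r - 1 := by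
    have : (1 : ℝ) ≤ 4 ^ r := one_le_pow₀ (by norm_num)
    have : (1 : ℝ) ≤ r := by exact_mod_cast hr
    linarith
  have hcpos : 0 < c := by rw [hc]; positivity
  have hinv (v : Fin r → ℝ) : euclNorm ((Q * A⁻¹ᵀ) *ᵥ v) ≤ c / m * euclNorm v := by
    rw [← mulVec_mulVec, euclNorm_mulVec_of_orthogonal hQ,
      ← sq_le_sq₀ (euclNorm_nonneg _) (by have := euclNorm_nonneg v; positivity), mul_pow]
    refine (euclNorm_mulVec_sq_le_frobenius _ _).trans
      (mul_le_mul_of_nonneg_right ?_ (sq_nonneg _))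
    rw [Finset.sum_comm]
    refine (sum_sq_inv_le_of_upperTri hAtri hAdet hdom hmpos hdiag).trans_eq ?_
    rw [hc, div_pow, div_pow, Real.sq_sqrt hrad.le]
    norm_num
  have hsig : 0 < sigmaMin U := by
    refine lt_of_lt_of_le (show 0 < m / c by positivity) (le_csInf ⟨_, q, hq1, rfl⟩ ?_)
    rintro _ ⟨x, hx, rfl⟩
    have h1 := hinv ((Pᵀ.submatrix (Fin.castLE hrp) id * U) *ᵥ x)
    rw [mulVec_mulVec, hleft, one_mulVec, hx, ← mulVec_mulVec] at h1
    have h2 := euclNorm_submatrix_mulVec_le (P := Pᵀ) (by rwa [transpose_transpose])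
      (Fin.castLE_injective hrp) (U *ᵥ x)
    have h3 := h1.trans (mul_le_mul_of_nonneg_left h2 (by positivity))
    rw [div_mul_eq_mul_div, le_div_iff₀ hmpos, one_mul] at h3
    rwa [div_le_iff₀' hcpos]
  refine ⟨(Matrix.isUnit_iff_isUnit_det _).1 (IsUnit.of_mul_eq_one_right _ hleft), hsig,
    fun v => ?_⟩
  rw [inv_eq_left_inv hleft, ← hc]
  refine (hinv v).trans (mul_le_mul_of_nonneg_right ?_ (euclNorm_nonneg _))
  rw [div_le_div_iff₀ hmpos hsig]
  have h := mul_le_mul_of_nonneg_left ((sigmaMin_mul_le U hq1).trans hUq) hcpos.le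
  linarith

/-- Interpolation error bound for QR pivot sensors, in terms of the discarded Hankel
singular values `σ_{r+1}, …, σ_n`. -/
theorem interp_error_qr_sensors {n p r : ℕ} (hr : 1 ≤ r) (hrn : r < n) (hrp : r ≤ p)
    (Ψ Φ : Matrix (Fin n) (Fin r) ℝ) (C : Matrix (Fin p) (Fin n) ℝ)
    (hrank : (C * Ψ).rank = r)
    (P : Matrix (Fin p) (Fin p) ℝ) (hP : IsPermMatrix P)
    (Q : Matrix (Fin r) (Fin r) ℝ) (hQ : Qᵀ * Q = 1)
    (R : Matrix (Fin r) (Fin p) ℝ) (hRtri : IsUpperTri R) (hRbg : BusingerGolub R)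
    (hQR : (C * Ψ)ᵀ * P = Q * R)
    (S : Matrix (Fin r) (Fin p) ℝ)
    (hS : S = Matrix.of fun (i : Fin r) (j : Fin p) => P j (Fin.castLE hrp i))
    (Chat : Matrix (Fin r) (Fin n) ℝ) (hChat : Chat = S * C)
    (PC : Matrix (Fin n) (Fin n) ℝ) (hPC : PC = Ψ * (Chat * Ψ)⁻¹ * Chat)
    (x xstar : Fin n → ℝ) (hxstar : xstar = Ψ.mulVec (Φᵀ.mulVec x))
    (σ : ℕ → ℝ) (hσ : ∀ i, r + 1 ≤ i → i ≤ n → 0 ≤ σ i)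
    (hres : euclNorm (x - xstar) ≤ 2 * ∑ i ∈ Finset.Icc (r + 1) n, σ i) :
    euclNorm (x - PC.mulVec x) ≤
      (specNorm C * specNorm Ψ / sigmaMin (C * Ψ)) *
        Real.sqrt ((p : ℝ) - r + 1) * (Real.sqrt ((4 : ℝ) ^ r + 6 * r - 1) / 3) *
        (2 * ∑ i ∈ Finset.Icc (r + 1) n, σ i) := by
  obtain ⟨τ, rfl⟩ := hP
  have hP : τ.permMatrix ℝ * (τ.permMatrix ℝ)ᵀ = 1 := by
    rw [transpose_permMatrix, ← permMatrix_mul, inv_mul_cancel, permMatrix_one]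
  have hU := mulVec_injective_of_rank_eq hrank
  obtain ⟨hdet, hsig, hinv⟩ :=
    isUnit_and_euclNorm_inv_mulVec_le_of_pivoted_qr hr hrp hU hP hQ hRtri hRbg hQR
  have hS' : S = (τ.permMatrix ℝ)ᵀ.submatrix (Fin.castLE hrp) id := hS
  rw [← hS', ← Matrix.mul_assoc, ← hChat] at hdet hinv
  have hPCΨ : PC * Ψ = Ψ := by
    rw [hPC, Matrix.mul_assoc, Matrix.mul_assoc, nonsing_inv_mul _ hdet, Matrix.mul_one]
  have hidem : PC * PC = PC := by
    nth_rewrite 2 [hPC]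
    rw [← Matrix.mul_assoc, ← Matrix.mul_assoc, hPCΨ, hPC]
  have hPC0 : PC ≠ 0 := by
    rintro h0
    rw [h0, Matrix.zero_mul] at hPCΨ
    rw [← hPCΨ, Matrix.mul_zero, rank_zero] at hrank
    omega
  obtain ⟨c, hc⟩ : ∃ c, c = Real.sqrt ((p : ℝ) - r + 1) *
    (Real.sqrt ((4 : ℝ) ^ r + 6 * r - 1) / 3) / sigmaMin (C * Ψ) := ⟨_, rfl⟩
  have hc0 : 0 ≤ c := by rw [hc]; positivity
  rw [← hc] at hinv
  have hCn := specNorm_nonneg C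
  have hΨn := specNorm_nonneg Ψ
  have hbound (y : Fin n → ℝ) :
      euclNorm (PC *ᵥ y) ≤ specNorm Ψ * (c * specNorm C) * euclNorm y := by
    have hSC : euclNorm (Chat *ᵥ y) ≤ specNorm C * euclNorm y := by
      rw [hChat, hS', ← mulVec_mulVec]
      exact (euclNorm_submatrix_mulVec_le (by rwa [transpose_transpose])
        (Fin.castLE_injective hrp) _).trans (euclNorm_mulVec_le C y)
    rw [hPC, ← mulVec_mulVec, ← mulVec_mulVec, mul_assoc, mul_assoc]
    exact (euclNorm_mulVec_le Ψ _).trans (mul_le_mul_of_nonneg_left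
      ((hinv _).trans (mul_le_mul_of_nonneg_left hSC hc0)) hΨn)
  have hsub : x - PC *ᵥ x = (x - xstar) - PC *ᵥ (x - xstar) := by
    rw [mulVec_sub, hxstar, mulVec_mulVec _ PC, hPCΨ]
    abel
  rw [hsub]
  refine (euclNorm_sub_mulVec_le_of_idempotent hidem hPC0 hbound _).trans
    ((mul_le_mul_of_nonneg_left hres (by positivity)).trans_eq ?_)
  rw [hc]
  ring
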